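/- Let k be a field and Π the preprojective algebra of the extended Dynkin quiver D̃_4 (one central vertex 0, four outer vertices, arrows from center to each outer vertex, doubled). Then the dimension of the degree-d component of Π (grading by path length) is 5(d+1) if d is even and 4(d+1) if d is odd. Equivalently its Hilbert series is (5 + 8t + 5t^2)/(1−t^2)^2. -/

import Mathlib

set_option synthInstance.maxHeartbeats 1000000
set_option maxHeartbeats 1000000

noncomputable section

/-- Generators of the preprojective algebra of the extended Dynkin quiver `D̃₄`, presented
with the four outer vertex idempotents `E i` and the doubled arrows `x i` (inwards) and
`y i` (outwards); the central vertex idempotent is `1 - ∑ E i`. -/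
inductive GenD4 : Type
  | E : Fin 4 → GenD4
  | x : Fin 4 → GenD4
  | y : Fin 4 → GenD4
deriving DecidableEq

variable (k : Type) [Field k]

/-- The image of a generator in the free algebra. -/
def gd4 (g : GenD4) : FreeAlgebra k GenD4 := FreeAlgebra.ι k g

open GenD4 in
/-- The defining relations of the preprojective algebra of `D̃₄` (cf. the presentation by
one central node and four outgoing arrows): the `E i` are orthogonal idempotents,
`E i * x j = δᵢⱼ x i`, `y i * E j = δᵢⱼ y i`, `x i * E j = E i * y j = 0`,
`x i * x j = y i * y j = 0`, and the two preprojective relations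
`∑ y i * x i = 0 = ∑ x i * y i`. -/
inductive RelD4 : FreeAlgebra k GenD4 → FreeAlgebra k GenD4 → Prop
  | ee (i j : Fin 4) : RelD4 (gd4 k (E i) * gd4 k (E j)) (if i = j then gd4 k (E i) else 0)
  | ex (i j : Fin 4) : RelD4 (gd4 k (E i) * gd4 k (x j)) (if i = j then gd4 k (x i) else 0)
  | ye (i j : Fin 4) : RelD4 (gd4 k (y i) * gd4 k (E j)) (if i = j then gd4 k (y i) else 0)
  | xe (i j : Fin 4) : RelD4 (gd4 k (x i) * gd4 k (E j)) 0
  | ey (i j : Fin 4) : RelD4 (gd4 k (E i) * gd4 k (y j)) 0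
  | xx (i j : Fin 4) : RelD4 (gd4 k (x i) * gd4 k (x j)) 0
  | yy (i j : Fin 4) : RelD4 (gd4 k (y i) * gd4 k (y j)) 0
  | yx : RelD4 (∑ i : Fin 4, gd4 k (y i) * gd4 k (x i)) 0
  | xy : RelD4 (∑ i : Fin 4, gd4 k (x i) * gd4 k (y i)) 0

/-- The preprojective algebra of `D̃₄` over `k`. -/
def PreprojD4 := RingQuot (RelD4 k)

instance : Ring (PreprojD4 k) := by unfold PreprojD4; infer_instance
instance : Algebra k (PreprojD4 k) := by unfold PreprojD4; infer_instance

/-- The degree of a generator: vertex idempotents have degree `0`, arrows degree `1`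
(grading by path length). -/
def degD4 : GenD4 → ℕ
  | .E _ => 0
  | _ => 1

/-- The degree-`d` homogeneous component of the preprojective algebra of `D̃₄`: the
`k`-span of (images of) words whose total arrow-length is `d`. -/
def PreprojD4Comp (d : ℕ) : Submodule k (PreprojD4 k) :=
  Submodule.span k
    {z | ∃ l : List GenD4, (l.map degD4).sum = d ∧
      z = (l.map fun g => RingQuot.mkAlgHom k (RelD4 k) (gd4 k g)).prod}

/-- A system of elements of a ring satisfying the defining relations of the preprojective
algebra of `D̃₄`. -/
structure D4System (A : Type) [Ring A] where
  /-- outer idempotents -/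
  E : Fin 4 → A
  /-- inward arrows -/
  x : Fin 4 → A
  /-- outward arrows -/
  y : Fin 4 → A
  ee (i j : Fin 4) : E i * E j = if i = j then E i else 0
  ex (i j : Fin 4) : E i * x j = if i = j then x i else 0
  ye (i j : Fin 4) : y i * E j = if i = j then y i else 0
  xe (i j : Fin 4) : x i * E j = 0
  ey (i j : Fin 4) : E i * y j = 0
  xx (i j : Fin 4) : x i * x j = 0
  yy (i j : Fin 4) : y i * y j = 0
  yx : ∑ i, y i * x i = 0
  xy : ∑ i, x i * y i = 0

/-- Index set of a basis of the preprojective algebra of `D̃₄` over the polynomial ring in two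
central elements of degree four: paths between outer vertices, paths from the centre outwards,
paths from outer vertices to the centre, and paths from the centre to itself. -/
abbrev D4Index := (Fin 2 × Fin 4 × Fin 4) ⊕ (Fin 4 × Fin 4) ⊕ (Fin 4 × Fin 4) ⊕ Fin 8

/-- The path length of a basis element. -/
def D4Index.deg : D4Index → ℕ
  | .inl (s, i, j) => if i = j then ![0, 6] s else ![2, 4] s
  | .inr (.inl (t, _)) => ![1, 3, 3, 5] t
  | .inr (.inr (.inl (t, _))) => ![1, 3, 3, 5] t
  | .inr (.inr (.inr t)) => ![0, 2, 2, 2, 4, 4, 4, 6] t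

/-- For distinct `i` and `j`, a choice of a third vertex. -/
def d4Mid (i j : Fin 4) : Fin 4 := if i = j + 1 then j + 2 else j + 1

/-- The three fixed-point-free involutions of the outer vertices given by pairings. -/
def d4Pair : Fin 3 → Fin 4 → Fin 4 := ![![1, 0, 3, 2], ![2, 3, 0, 1], ![3, 2, 1, 0]]

namespace D4System

variable {A : Type} [Ring A] (D : D4System A)

/-- The loop at the centre through the `i`-th outer vertex. -/
def a (i : Fin 4) : A := D.y i * D.x i

/-- The idempotent of the central vertex. -/
def e0 : A := 1 - ∑ i, D.E i

/-- The central element attached to a pairing of the outer vertices. -/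
def Z (s : Fin 3) : A :=
  D.a 0 * D.a (d4Pair s 0) + D.a (d4Pair s 0) * D.a 0 +
    ∑ i, D.x i * (D.a (d4Pair s i) * D.y i)

/-- The basis elements. -/
def val : D4Index → A
  | .inl (s, i, j) =>
      if i = j then ![D.E i, D.x i * (D.a (i + 1) * (D.a (i + 2) * D.y i))] s
      else ![D.x i * D.y j, D.x i * (D.a (d4Mid i j) * D.y j)] s
  | .inr (.inl (t, j)) =>
      ![D.y j, D.a (j + 1) * D.y j, D.a (j + 2) * D.y j, D.a (j + 1) * (D.a (j + 2) * D.y j)] t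
  | .inr (.inr (.inl (t, i))) =>
      ![D.x i, D.x i * D.a (i + 1), D.x i * D.a (i + 2), D.x i * (D.a (i + 1) * D.a (i + 2))] t
  | .inr (.inr (.inr t)) =>
      ![D.e0, D.a 0, D.a 1, D.a 2, D.a 0 * D.a 1, D.a 0 * D.a 2, D.a 1 * D.a 2,
        D.a 0 * (D.a 1 * D.a 2)] t

lemma xy_self (i : Fin 4) : D.x i * D.y i = 0 := by
  have h := congrArg (D.E i * ·) D.xy
  simpa [Finset.mul_sum, ← mul_assoc, D.ex, ite_mul] using h

lemma y_mul_E_self (i : Fin 4) : D.y i * D.E i = D.y i := by simp [D.ye]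

lemma E_mul_x_self (i : Fin 4) : D.E i * D.x i = D.x i := by simp [D.ex]

lemma yx_ne {i j : Fin 4} (h : i ≠ j) : D.y i * D.x j = 0 := by
  rw [← D.y_mul_E_self i, mul_assoc, D.ex, if_neg h, mul_zero]

lemma sum_a : ∑ i, D.a i = 0 := D.yx

lemma x_mul_e0 (i : Fin 4) : D.x i * D.e0 = D.x i := by
  simp [e0, mul_sub, Finset.mul_sum, D.xe]

lemma e0_mul_y (i : Fin 4) : D.e0 * D.y i = D.y i := by
  simp [e0, sub_mul, Finset.sum_mul, D.ey]

lemma y_mul_e0 (i : Fin 4) : D.y i * D.e0 = 0 := by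
  simp [e0, mul_sub, Finset.mul_sum, D.ye]

lemma e0_mul_x (i : Fin 4) : D.e0 * D.x i = 0 := by
  simp [e0, sub_mul, Finset.sum_mul, D.ex]

lemma E_mul_e0 (i : Fin 4) : D.E i * D.e0 = 0 := by
  simp [e0, mul_sub, Finset.mul_sum, D.ee]

lemma e0_mul_E (i : Fin 4) : D.e0 * D.E i = 0 := by
  simp [e0, sub_mul, Finset.sum_mul, D.ee]

lemma e0_mul_e0 : D.e0 * D.e0 = D.e0 := by
  nth_rw 1 [e0]
  rw [sub_mul, Finset.sum_mul, Finset.sum_eq_zero fun i _ => D.E_mul_e0 i, one_mul, sub_zero]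

lemma e0_mul_a (i : Fin 4) : D.e0 * D.a i = D.a i := by
  rw [a, ← mul_assoc, D.e0_mul_y]

lemma a_mul_e0 (i : Fin 4) : D.a i * D.e0 = D.a i := by
  rw [a, mul_assoc, D.x_mul_e0]

lemma x_a (i : Fin 4) : D.x i * D.a i = 0 := by
  rw [a, ← mul_assoc, D.xy_self, zero_mul]

lemma a_y (i : Fin 4) : D.a i * D.y i = 0 := by
  rw [a, mul_assoc, D.xy_self, mul_zero]

lemma a_a (i : Fin 4) : D.a i * D.a i = 0 := by
  nth_rw 2 [a]
  rw [← mul_assoc, D.a_y, zero_mul]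

lemma a_E (i j : Fin 4) : D.a i * D.E j = 0 := by
  rw [a, mul_assoc, D.xe, mul_zero]

lemma E_a (i j : Fin 4) : D.E i * D.a j = 0 := by
  rw [a, ← mul_assoc, D.ey, zero_mul]

lemma y_a (i j : Fin 4) : D.y i * D.a j = 0 := by
  rw [a, ← mul_assoc, D.yy, zero_mul]

lemma assoc_of_eq_zero {u v : A} (h : u * v = 0) (t : A) : u * (v * t) = 0 := by
  rw [← mul_assoc, h, zero_mul]

lemma a_three : D.a 3 = -(D.a 0 + D.a 1 + D.a 2) := by
  have h := D.sum_a
  rw [Fin.sum_univ_four] at h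
  exact eq_neg_of_add_eq_zero_right h

/-- The anticommutators of the two loops of each pair agree. -/
lemma anticomm_pair (s : Fin 3) (i : Fin 4) :
    D.a i * D.a (d4Pair s i) + D.a (d4Pair s i) * D.a i =
      D.a 0 * D.a (d4Pair s 0) + D.a (d4Pair s 0) * D.a 0 := by
  have h0 := D.a_a 0
  have h1 := D.a_a 1
  have h2 := D.a_a 2
  have h3 := D.a_a 3
  rw [a_three] at h3
  have h : D.a 0 * D.a 1 + D.a 1 * D.a 0 + (D.a 0 * D.a 2 + D.a 2 * D.a 0) +
      (D.a 1 * D.a 2 + D.a 2 * D.a 1) = 0 := by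
    calc _ = -(D.a 0 + D.a 1 + D.a 2) * -(D.a 0 + D.a 1 + D.a 2)
          - D.a 0 * D.a 0 - D.a 1 * D.a 1 - D.a 2 * D.a 2 := by noncomm_ring
      _ = 0 := by rw [h0, h1, h2, h3]; simp
  fin_cases s <;> fin_cases i <;>
    simp [d4Pair, a_three, mul_add, add_mul, h0, h1, h2] <;>
    first
      | abel1
      | (rw [← sub_eq_zero, ← h]; abel1)
      | (rw [← sub_eq_zero, ← neg_eq_zero, ← h]; abel1)

lemma Z_mul_E (s : Fin 3) (i : Fin 4) :
    D.Z s * D.E i = D.x i * (D.a (d4Pair s i) * D.y i) := by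
  simp [Z, add_mul, Finset.sum_mul, mul_assoc, D.a_E, D.ye]

lemma E_mul_Z (s : Fin 3) (i : Fin 4) :
    D.E i * D.Z s = D.x i * (D.a (d4Pair s i) * D.y i) := by
  simp [Z, mul_add, Finset.mul_sum, ← mul_assoc, D.E_a, D.ex]

lemma Z_mul_e0 (s : Fin 3) (i : Fin 4) :
    D.Z s * D.e0 = D.a i * D.a (d4Pair s i) + D.a (d4Pair s i) * D.a i := by
  rw [D.anticomm_pair s i]
  simp [Z, add_mul, Finset.sum_mul, mul_assoc, D.a_mul_e0, D.y_mul_e0]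

lemma Z_mul_y (s : Fin 3) (i : Fin 4) : D.Z s * D.y i = D.a i * (D.a (d4Pair s i) * D.y i) := by
  rw [← D.e0_mul_y i, ← mul_assoc, D.Z_mul_e0 s i, D.e0_mul_y, add_mul, mul_assoc, mul_assoc,
    D.a_y, mul_zero, add_zero]

lemma Z_comm_y (s : Fin 3) (i : Fin 4) : D.Z s * D.y i = D.y i * D.Z s := by
  rw [D.Z_mul_y, ← D.y_mul_E_self i, mul_assoc, D.E_mul_Z, D.y_mul_E_self, a, mul_assoc]

lemma Z_mul_x (s : Fin 3) (i : Fin 4) :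
    D.Z s * D.x i = D.x i * (D.a (d4Pair s i) * D.a i) := by
  rw [← D.E_mul_x_self i, ← mul_assoc, D.Z_mul_E, D.E_mul_x_self, mul_assoc, mul_assoc, ← a]

lemma e0_mul_Z (s : Fin 3) (i : Fin 4) :
    D.e0 * D.Z s = D.a i * D.a (d4Pair s i) + D.a (d4Pair s i) * D.a i := by
  rw [D.anticomm_pair s i]
  simp [Z, mul_add, Finset.mul_sum, ← mul_assoc, D.e0_mul_a, D.e0_mul_x]

lemma Z_comm_x (s : Fin 3) (i : Fin 4) : D.Z s * D.x i = D.x i * D.Z s := by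
  rw [D.Z_mul_x]
  conv_rhs => rw [← D.x_mul_e0 i, mul_assoc, D.e0_mul_Z s i, mul_add, assoc_of_eq_zero (D.x_a i)]
  rw [zero_add]

lemma Z_comm_E (s : Fin 3) (i : Fin 4) : D.Z s * D.E i = D.E i * D.Z s := by
  rw [Z_mul_E, E_mul_Z]

lemma sum_Z : D.Z 0 + D.Z 1 + D.Z 2 = 0 := by
  have h : (D.Z 0 + D.Z 1 + D.Z 2) * (∑ i, D.E i + D.e0) = 0 := by
    rw [mul_add, Finset.mul_sum]
    have h1 : ∀ i, (D.Z 0 + D.Z 1 + D.Z 2) * D.E i = 0 := by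
      intro i
      have : D.a (d4Pair 0 i) + D.a (d4Pair 1 i) + D.a (d4Pair 2 i) = -D.a i := by
        fin_cases i <;> simp [d4Pair, a_three] <;> abel
      rw [add_mul, add_mul, Z_mul_E, Z_mul_E, Z_mul_E, ← mul_add, ← add_mul, ← mul_add, ← add_mul,
        this, neg_mul, D.a_y, neg_zero, mul_zero]
    have h2 : (D.Z 0 + D.Z 1 + D.Z 2) * D.e0 = 0 := by
      rw [add_mul, add_mul, D.Z_mul_e0 0 0, D.Z_mul_e0 1 0, D.Z_mul_e0 2 0]
      simp [d4Pair, a_three, mul_add, add_mul, D.a_a]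
      abel
    simp [h1, h2]
  simpa [e0] using h

end D4System

namespace D4System

variable {A : Type} [Ring A] (D : D4System A)

lemma exists_pair {i j : Fin 4} (h : i ≠ j) : ∃ s, d4Pair s i = j := by
  revert i j; decide

lemma Z_comm_Z (s s' : Fin 3) : Commute (D.Z s) (D.Z s') := by
  have hx : ∀ i, Commute (D.Z s) (D.x i) := D.Z_comm_x s
  have hy : ∀ i, Commute (D.Z s) (D.y i) := D.Z_comm_y s
  have ha : ∀ i, Commute (D.Z s) (D.a i) := fun i => (hy i).mul_right (hx i)
  exact (((ha _).mul_right (ha _)).add_right ((ha _).mul_right (ha _))).add_right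
    (Commute.sum_right _ _ _ fun i _ => (hx i).mul_right ((ha _).mul_right (hy i)))

lemma exists_swap {i j : Fin 4} (h : i ≠ j) : ∃ s, ∀ t, D.e0 * t = t →
    D.a i * (D.a j * t) = D.Z s * t - D.a j * (D.a i * t) := by
  obtain ⟨s, rfl⟩ := exists_pair h
  refine ⟨s, fun t ht => ?_⟩
  rw [eq_sub_iff_add_eq, ← mul_assoc, ← mul_assoc, ← add_mul, ← D.Z_mul_e0, mul_assoc, ht]

lemma exists_swap_x {i j : Fin 4} (h : i ≠ j) : ∃ s, ∀ t, D.e0 * t = t →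
    D.x i * (D.a j * (D.a i * t)) = D.Z s * (D.x i * t) := by
  obtain ⟨s, hs⟩ := D.exists_swap h
  refine ⟨s, fun t ht => ?_⟩
  have h := congrArg (D.x i * ·) (hs t ht)
  simp only [mul_sub, assoc_of_eq_zero (D.x_a i)] at h
  rw [← sub_eq_zero.mp h.symm, ← mul_assoc, ← mul_assoc, D.Z_comm_x]

lemma e0_mul_a_mul (i : Fin 4) (t : A) : D.e0 * (D.a i * t) = D.a i * t := by
  rw [← mul_assoc, D.e0_mul_a]

variable (K : Type) [Field K] [Algebra K A]

/-- The span of the products of powers of the central elements with basis elements which have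
total path length `d`. -/
def comp (d : ℕ) : Submodule K A :=
  Submodule.span K {z | ∃ b : D4Index, ∃ i j : ℕ, b.deg + 4 * (i + j) = d ∧
    z = D.Z 0 ^ i * (D.Z 1 ^ j * D.val b)}

lemma val_mem (b : D4Index) : D.val b ∈ D.comp K b.deg :=
  Submodule.subset_span ⟨b, 0, 0, by simp⟩

lemma mul_mem_of_generators {d e : ℕ} (u : A)
    (h : ∀ b : D4Index, ∀ i j : ℕ, b.deg + 4 * (i + j) = d →
      u * (D.Z 0 ^ i * (D.Z 1 ^ j * D.val b)) ∈ D.comp K e) {t : A} (ht : t ∈ D.comp K d) :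
    u * t ∈ D.comp K e := by
  induction ht using Submodule.span_induction with
  | mem z hz =>
    obtain ⟨b, i, j, hd, rfl⟩ := hz
    exact h b i j hd
  | zero => simp
  | add z w _ _ hz hw => rw [mul_add]; exact add_mem hz hw
  | smul c z _ hz => rw [mul_smul_comm]; exact Submodule.smul_mem _ _ hz

lemma Z_mul_mem (s : Fin 3) {d : ℕ} {t : A} (ht : t ∈ D.comp K d) :
    D.Z s * t ∈ D.comp K (d + 4) := by
  have h0 : D.Z 0 * t ∈ D.comp K (d + 4) :=
    D.mul_mem_of_generators K _ (fun b i j hd => Submodule.subset_span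
      ⟨b, i + 1, j, by omega, by rw [pow_succ', mul_assoc]⟩) ht
  have h1 : D.Z 1 * t ∈ D.comp K (d + 4) :=
    D.mul_mem_of_generators K _ (fun b i j hd => Submodule.subset_span
      ⟨b, i, j + 1, by omega, by
        rw [← mul_assoc, ((D.Z_comm_Z 1 0).pow_right i).eq, mul_assoc, pow_succ', mul_assoc]⟩) ht
  fin_cases s
  · exact h0
  · exact h1
  · have h2 : D.Z 2 = -(D.Z 0 + D.Z 1) := eq_neg_of_add_eq_zero_right D.sum_Z
    change D.Z 2 * t ∈ _
    rw [h2, neg_mul, add_mul]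
    exact neg_mem (add_mem h0 h1)

lemma Z_pow_mul_mem (s : Fin 3) (n : ℕ) {d : ℕ} {t : A} (ht : t ∈ D.comp K d) :
    D.Z s ^ n * t ∈ D.comp K (d + 4 * n) := by
  induction n with
  | zero => simpa using ht
  | succ n ih =>
    rw [pow_succ', mul_assoc]
    exact D.Z_mul_mem K s ih

lemma mem_of_sum_eq_zero {N : Submodule K A} {f : Fin 4 → A} (hf : ∑ i, f i = 0) (m : Fin 4)
    (h : ∀ i, i ≠ m → f i ∈ N) (i : Fin 4) : f i ∈ N := by
  by_cases hi : i = m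
  · subst hi
    rw [← Finset.add_sum_erase _ _ (Finset.mem_univ i)] at hf
    rw [eq_neg_of_add_eq_zero_left hf]
    exact neg_mem (sum_mem fun j hj => h j (Finset.ne_of_mem_erase hj))
  · exact h i hi

lemma sum_a_mul (t : A) : ∑ i, D.a i * t = 0 := by
  rw [← Finset.sum_mul, D.sum_a, zero_mul]

lemma sum_mul_a (t : A) : ∑ i, t * D.a i = 0 := by
  rw [← Finset.mul_sum, D.sum_a, mul_zero]

lemma sum_mul_a_mul (u t : A) : ∑ i, u * (D.a i * t) = 0 := by
  rw [← Finset.mul_sum, D.sum_a_mul, mul_zero]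

lemma eq_of_ne_add_three {i j : Fin 4} (h : i ≠ j + 3) : i = j ∨ i = j + 1 ∨ i = j + 2 := by
  revert i j; decide

lemma ne_add_one (j : Fin 4) : j ≠ j + 1 := by revert j; decide

lemma ne_add_two (j : Fin 4) : j ≠ j + 2 := by revert j; decide

lemma add_two_ne_add_one (j : Fin 4) : j + 2 ≠ j + 1 := by revert j; decide

lemma E_mem (i : Fin 4) : D.E i ∈ D.comp K 0 := by
  simpa [val, D4Index.deg] using D.val_mem K (.inl (0, i, i))

lemma xaay_self_mem (i : Fin 4) :
    D.x i * (D.a (i + 1) * (D.a (i + 2) * D.y i)) ∈ D.comp K 6 := by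
  simpa [val, D4Index.deg] using D.val_mem K (.inl (1, i, i))

lemma xy_mem (i j : Fin 4) : D.x i * D.y j ∈ D.comp K 2 := by
  by_cases h : i = j
  · rw [h, D.xy_self]; exact zero_mem _
  · simpa [val, D4Index.deg, h] using D.val_mem K (.inl (0, i, j))

lemma y_mem (j : Fin 4) : D.y j ∈ D.comp K 1 := D.val_mem K (.inr (.inl (0, j)))

lemma x_mem (j : Fin 4) : D.x j ∈ D.comp K 1 := D.val_mem K (.inr (.inr (.inl (0, j))))

lemma e0_mem : D.e0 ∈ D.comp K 0 := D.val_mem K (.inr (.inr (.inr 0)))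

lemma xay_mem (p i j : Fin 4) : D.x p * (D.a i * D.y j) ∈ D.comp K 4 := by
  by_cases hpj : p = j
  · subst hpj
    by_cases hpi : p = i
    · subst hpi
      rw [D.a_y, mul_zero]; exact zero_mem _
    · obtain ⟨s, rfl⟩ := exists_pair hpi
      rw [← D.Z_mul_E]
      exact D.Z_mul_mem K s (D.E_mem K p)
  · have key : ∀ p j : Fin 4, p ≠ j → ∃ m, ∀ i, i ≠ m → i = p ∨ i = j ∨ i = d4Mid p j := by
      decide
    obtain ⟨m, hm⟩ := key p j hpj
    refine mem_of_sum_eq_zero K (D.sum_mul_a_mul (D.x p) (D.y j)) m (fun i hi => ?_) i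
    rcases hm i hi with rfl | rfl | rfl
    · rw [assoc_of_eq_zero (D.x_a _)]; exact zero_mem _
    · rw [D.a_y, mul_zero]; exact zero_mem _
    · simpa [val, D4Index.deg, hpj] using D.val_mem K (.inl (1, p, j))

lemma ay_mem (i j : Fin 4) : D.a i * D.y j ∈ D.comp K 3 := by
  refine mem_of_sum_eq_zero K (D.sum_a_mul (D.y j)) (j + 3) (fun i hi => ?_) i
  rcases eq_of_ne_add_three hi with rfl | rfl | rfl
  · rw [D.a_y]; exact zero_mem _
  · exact D.val_mem K (.inr (.inl (1, j)))
  · exact D.val_mem K (.inr (.inl (2, j)))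

lemma aay_mem (i l j : Fin 4) : D.a i * (D.a l * D.y j) ∈ D.comp K 5 := by
  have hb : D.a (j + 1) * (D.a (j + 2) * D.y j) ∈ D.comp K 5 :=
    D.val_mem K (.inr (.inl (3, j)))
  have h0 : ∀ i, D.a i * (D.a j * D.y j) ∈ D.comp K 5 := fun i => by
    rw [D.a_y, mul_zero]; exact zero_mem _
  have hj : ∀ l, l ≠ j → D.a j * (D.a l * D.y j) ∈ D.comp K 5 := fun l hl => by
    obtain ⟨s, hs⟩ := D.exists_swap hl.symm
    rw [hs _ (D.e0_mul_y j)]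
    exact sub_mem (D.Z_mul_mem K s (D.y_mem K j)) (h0 l)
  refine mem_of_sum_eq_zero K (D.sum_mul_a_mul (D.a i) (D.y j)) (j + 3) (fun l hl => ?_) l
  refine mem_of_sum_eq_zero K (D.sum_a_mul (D.a l * D.y j)) (j + 3) (fun i hi => ?_) i
  rcases eq_of_ne_add_three hl with rfl | rfl | rfl
  · exact h0 i
  · rcases eq_of_ne_add_three hi with rfl | rfl | rfl
    · exact hj _ (ne_add_one _).symm
    · rw [assoc_of_eq_zero (D.a_a _)]; exact zero_mem _
    · obtain ⟨s, hs⟩ := D.exists_swap (add_two_ne_add_one j)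
      rw [hs _ (D.e0_mul_y j)]
      exact sub_mem (D.Z_mul_mem K s (D.y_mem K j)) hb
  · rcases eq_of_ne_add_three hi with rfl | rfl | rfl
    · exact hj _ (ne_add_two _).symm
    · exact hb
    · rw [assoc_of_eq_zero (D.a_a _)]; exact zero_mem _

lemma aaay_mem (j : Fin 4) :
    D.a j * (D.a (j + 1) * (D.a (j + 2) * D.y j)) ∈ D.comp K 7 := by
  obtain ⟨s, hs⟩ := D.exists_swap (ne_add_one j)
  obtain ⟨s', hs'⟩ := D.exists_swap (ne_add_two j)
  rw [hs _ (by rw [e0_mul_a_mul]), hs' _ (D.e0_mul_y j), D.a_y, mul_zero, sub_zero, ← mul_assoc,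
    ← mul_assoc (D.a (j + 1))]
  have hc : D.a (j + 1) * D.Z s' = D.Z s' * D.a (j + 1) := by
    rw [a, mul_assoc, ← D.Z_comm_x, ← mul_assoc, ← D.Z_comm_y, mul_assoc]
  rw [hc, mul_assoc, mul_assoc]
  exact sub_mem (D.Z_mul_mem K s (D.ay_mem K _ _)) (D.Z_mul_mem K s' (D.ay_mem K _ _))

lemma xaay_mem (p j : Fin 4) :
    D.x p * (D.a (j + 1) * (D.a (j + 2) * D.y j)) ∈ D.comp K 6 := by
  by_cases hp : p = j + 3
  · subst hp
    have h2 : j + 2 ≠ j := (ne_add_two j).symm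
    have h := D.sum_mul_a_mul (D.x (j + 3)) (D.a (j + 2) * D.y j)
    refine mem_of_sum_eq_zero K h (j + 1) (fun i hi => ?_) (j + 1)
    have key : ∀ i j : Fin 4, i ≠ j + 1 → i = j ∨ i = j + 2 ∨ i = j + 3 := by decide
    rcases key i j hi with rfl | rfl | rfl
    · obtain ⟨s, hs⟩ := D.exists_swap h2.symm
      rw [hs _ (D.e0_mul_y _), D.a_y, mul_zero, sub_zero, ← mul_assoc, ← D.Z_comm_x, mul_assoc]
      exact D.Z_mul_mem K s (D.xy_mem K _ _)
    · rw [assoc_of_eq_zero (D.a_a _), mul_zero]; exact zero_mem _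
    · rw [assoc_of_eq_zero (D.x_a _)]; exact zero_mem _
  · rcases eq_of_ne_add_three hp with rfl | rfl | rfl
    · exact D.xaay_self_mem K _
    · rw [assoc_of_eq_zero (D.x_a _)]; exact zero_mem _
    · obtain ⟨s, hs⟩ := D.exists_swap_x (add_two_ne_add_one j)
      rw [hs _ (D.e0_mul_y _)]
      exact D.Z_mul_mem K s (D.xy_mem K _ _)

lemma xa_mem (p i : Fin 4) : D.x p * D.a i ∈ D.comp K 3 := by
  refine mem_of_sum_eq_zero K (D.sum_mul_a (D.x p)) (p + 3) (fun i hi => ?_) i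
  rcases eq_of_ne_add_three hi with rfl | rfl | rfl
  · rw [D.x_a]; exact zero_mem _
  · exact D.val_mem K (.inr (.inr (.inl (1, p))))
  · exact D.val_mem K (.inr (.inr (.inl (2, p))))

lemma xaa_mem (p i l : Fin 4) : D.x p * (D.a i * D.a l) ∈ D.comp K 5 := by
  have hb : D.x p * (D.a (p + 1) * D.a (p + 2)) ∈ D.comp K 5 :=
    D.val_mem K (.inr (.inr (.inl (3, p))))
  have h0 : ∀ l, D.x p * (D.a p * D.a l) ∈ D.comp K 5 := fun l => by
    rw [assoc_of_eq_zero (D.x_a _)]; exact zero_mem _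
  have hp : ∀ i, p ≠ i → D.x p * (D.a i * D.a p) ∈ D.comp K 5 := fun i hi => by
    obtain ⟨s, hs⟩ := D.exists_swap_x hi
    have h := hs _ D.e0_mul_e0
    rw [D.a_mul_e0, D.x_mul_e0] at h
    rw [h]
    exact D.Z_mul_mem K s (D.x_mem K p)
  refine mem_of_sum_eq_zero K (D.sum_mul_a_mul (D.x p) (D.a l)) (p + 3) (fun i hi => ?_) i
  have hsum : ∑ l, D.x p * (D.a i * D.a l) = 0 := by
    rw [← Finset.mul_sum, D.sum_mul_a, mul_zero]
  refine mem_of_sum_eq_zero K hsum (p + 3) (fun l hl => ?_) l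
  rcases eq_of_ne_add_three hi with rfl | rfl | rfl
  · exact h0 l
  · rcases eq_of_ne_add_three hl with rfl | rfl | rfl
    · exact hp _ (ne_add_one _)
    · rw [D.a_a, mul_zero]; exact zero_mem _
    · exact hb
  · rcases eq_of_ne_add_three hl with rfl | rfl | rfl
    · exact hp _ (ne_add_two _)
    · obtain ⟨s, hs⟩ := D.exists_swap (add_two_ne_add_one p)
      have h := hs _ D.e0_mul_e0
      rw [D.a_mul_e0, D.a_mul_e0] at h
      rw [h, mul_sub, ← mul_assoc, ← D.Z_comm_x, mul_assoc, D.x_mul_e0]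
      exact sub_mem (D.Z_mul_mem K s (D.x_mem K p)) hb
    · rw [D.a_a, mul_zero]; exact zero_mem _

end D4System

namespace D4System

variable {A : Type} [Ring A] (D : D4System A)

lemma a_comm_Z (i : Fin 4) (s : Fin 3) (t : A) : D.a i * (D.Z s * t) = D.Z s * (D.a i * t) := by
  rw [a, ← mul_assoc, mul_assoc (D.y i), ← D.Z_comm_x, ← mul_assoc, ← D.Z_comm_y]
  simp only [mul_assoc]

lemma x_comm_Z (i : Fin 4) (s : Fin 3) (t : A) : D.x i * (D.Z s * t) = D.Z s * (D.x i * t) := by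
  rw [← mul_assoc, ← D.Z_comm_x, mul_assoc]

lemma exists_anticomm {i j : Fin 4} (h : i ≠ j) : ∃ s,
    D.a i * D.a j = D.Z s * D.e0 - D.a j * D.a i := by
  obtain ⟨s, hs⟩ := D.exists_swap h
  refine ⟨s, ?_⟩
  have h := hs _ D.e0_mul_e0
  rwa [D.a_mul_e0, D.a_mul_e0] at h

variable (K : Type) [Field K] [Algebra K A]

lemma xaaa_mem (p : Fin 4) : D.x p * (D.a 0 * (D.a 1 * D.a 2)) ∈ D.comp K 7 := by
  have h0 : D.x 0 * (D.a 0 * (D.a 1 * D.a 2)) ∈ D.comp K 7 := by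
    rw [assoc_of_eq_zero (D.x_a _)]; exact zero_mem _
  have h1 : D.x 1 * (D.a 0 * (D.a 1 * D.a 2)) ∈ D.comp K 7 := by
    obtain ⟨s, hs⟩ := D.exists_swap_x (i := 1) (j := 0) (by decide)
    rw [hs _ (D.e0_mul_a 2)]
    exact D.Z_mul_mem K s (D.xa_mem K _ _)
  have h2 : D.x 2 * (D.a 0 * (D.a 1 * D.a 2)) ∈ D.comp K 7 := by
    obtain ⟨s, hs⟩ := D.exists_anticomm (i := 1) (j := 2) (by decide)
    obtain ⟨s', hs'⟩ := D.exists_swap_x (i := 2) (j := 0) (by decide)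
    rw [hs, mul_sub, mul_sub, D.a_comm_Z, D.x_comm_Z, D.a_mul_e0, hs' _ (D.e0_mul_a 1)]
    exact sub_mem (D.Z_mul_mem K s (D.xa_mem K _ _)) (D.Z_mul_mem K s' (D.xa_mem K _ _))
  have h3 : D.x 3 * (D.a 0 * (D.a 1 * D.a 2)) ∈ D.comp K 7 := by
    refine mem_of_sum_eq_zero K (D.sum_mul_a_mul (D.x 3) (D.a 1 * D.a 2)) 0 (fun i hi => ?_) 0
    have key : ∀ i : Fin 4, i ≠ 0 → i = 1 ∨ i = 2 ∨ i = 3 := by decide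
    rcases key i hi with rfl | rfl | rfl
    · rw [assoc_of_eq_zero (D.a_a _), mul_zero]; exact zero_mem _
    · obtain ⟨s, hs⟩ := D.exists_swap (i := 2) (j := 1) (by decide)
      rw [hs _ (D.e0_mul_a 2), D.a_a, mul_zero, sub_zero, D.x_comm_Z]
      exact D.Z_mul_mem K s (D.xa_mem K _ _)
    · rw [assoc_of_eq_zero (D.x_a _)]; exact zero_mem _
  fin_cases p <;> assumption

lemma eq_of_ne_three {i : Fin 4} (h : i ≠ 3) : i = 0 ∨ i = 1 ∨ i = 2 := by
  revert i; decide

lemma a_mem (i : Fin 4) : D.a i ∈ D.comp K 2 := by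
  refine mem_of_sum_eq_zero K D.sum_a 3 (fun i hi => ?_) i
  rcases eq_of_ne_three hi with rfl | rfl | rfl
  · exact D.val_mem K (.inr (.inr (.inr 1)))
  · exact D.val_mem K (.inr (.inr (.inr 2)))
  · exact D.val_mem K (.inr (.inr (.inr 3)))

lemma aa_mem (i j : Fin 4) : D.a i * D.a j ∈ D.comp K 4 := by
  have hs : ∀ i j, D.a j * D.a i ∈ D.comp K 4 → D.a i * D.a j ∈ D.comp K 4 := fun i j h => by
    by_cases hij : i = j
    · rwa [hij] at h ⊢
    · obtain ⟨s, hs⟩ := D.exists_anticomm hij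
      rw [hs]
      exact sub_mem (D.Z_mul_mem K s (D.e0_mem K)) h
  have h0 : ∀ i, D.a i * D.a i ∈ D.comp K 4 := fun i => by rw [D.a_a]; exact zero_mem _
  have h01 : D.a 0 * D.a 1 ∈ D.comp K 4 := D.val_mem K (.inr (.inr (.inr 4)))
  have h02 : D.a 0 * D.a 2 ∈ D.comp K 4 := D.val_mem K (.inr (.inr (.inr 5)))
  have h12 : D.a 1 * D.a 2 ∈ D.comp K 4 := D.val_mem K (.inr (.inr (.inr 6)))
  refine mem_of_sum_eq_zero K (D.sum_mul_a (D.a i)) 3 (fun j hj => ?_) j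
  refine mem_of_sum_eq_zero K (D.sum_a_mul (D.a j)) 3 (fun i hi => ?_) i
  rcases eq_of_ne_three hi with rfl | rfl | rfl <;>
    rcases eq_of_ne_three hj with rfl | rfl | rfl <;>
    first
      | exact h0 _
      | assumption
      | (apply hs; assumption)

lemma aaa_mem (i j l : Fin 4) : D.a i * (D.a j * D.a l) ∈ D.comp K 6 := by
  have h12 : ∀ i j l, i ≠ j → D.a j * (D.a i * D.a l) ∈ D.comp K 6 →
      D.a i * (D.a j * D.a l) ∈ D.comp K 6 := fun i j l hij h => by
    obtain ⟨s, hs⟩ := D.exists_swap hij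
    rw [hs _ (D.e0_mul_a l)]
    exact sub_mem (D.Z_mul_mem K s (D.a_mem K l)) h
  have h23 : ∀ i j l, j ≠ l → D.a i * (D.a l * D.a j) ∈ D.comp K 6 →
      D.a i * (D.a j * D.a l) ∈ D.comp K 6 := fun i j l hjl h => by
    obtain ⟨s, hs⟩ := D.exists_anticomm hjl
    rw [hs, mul_sub, D.a_comm_Z, D.a_mul_e0]
    exact sub_mem (D.Z_mul_mem K s (D.a_mem K i)) h
  have hjj : ∀ i j, D.a i * (D.a j * D.a j) ∈ D.comp K 6 := fun i j => by
    rw [D.a_a, mul_zero]; exact zero_mem _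
  have hii : ∀ i j, D.a i * (D.a i * D.a j) ∈ D.comp K 6 := fun i j => by
    rw [assoc_of_eq_zero (D.a_a i)]; exact zero_mem _
  have hij : ∀ i j, D.a i * (D.a j * D.a i) ∈ D.comp K 6 := fun i j => by
    by_cases h : i = j
    · rw [h]; exact hjj j j
    · exact h12 _ _ _ h (hjj j i)
  have h012 : D.a 0 * (D.a 1 * D.a 2) ∈ D.comp K 6 := D.val_mem K (.inr (.inr (.inr 7)))
  have h102 := h12 1 0 2 (by decide) h012
  have h021 := h23 0 2 1 (by decide) h012
  have h201 := h12 2 0 1 (by decide) h021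
  have h120 := h23 1 2 0 (by decide) h102
  have h210 := h12 2 1 0 (by decide) h120
  have hs : ∑ l, D.a i * (D.a j * D.a l) = 0 := by
    rw [← Finset.mul_sum, D.sum_mul_a, mul_zero]
  refine mem_of_sum_eq_zero K hs 3 (fun l hl => ?_) l
  refine mem_of_sum_eq_zero K (D.sum_mul_a_mul (D.a i) (D.a l)) 3 (fun j hj => ?_) j
  refine mem_of_sum_eq_zero K (D.sum_a_mul (D.a j * D.a l)) 3 (fun i hi => ?_) i
  rcases eq_of_ne_three hi with rfl | rfl | rfl <;>
    rcases eq_of_ne_three hj with rfl | rfl | rfl <;>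
    rcases eq_of_ne_three hl with rfl | rfl | rfl <;>
    first
      | assumption
      | exact hii _ _
      | exact hjj _ _
      | exact hij _ _

lemma E_mul_val_mem (p : Fin 4) (b : D4Index) : D.E p * D.val b ∈ D.comp K b.deg := by
  suffices h : D.E p * D.val b = 0 ∨ D.E p * D.val b = D.val b by
    rcases h with h | h <;> rw [h]
    · exact zero_mem _
    · exact D.val_mem K b
  rcases b with ⟨s, i, j⟩ | ⟨t, j⟩ | ⟨t, i⟩ | t
  · by_cases hp : p = i
    · right
      by_cases hij : i = j <;> fin_cases s <;> simp [val, hp, hij, ← mul_assoc, D.ee, D.ex]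
    · left
      rcases eq_or_ne i j with rfl | hij
      · fin_cases s <;> simp [val, ← mul_assoc, D.ee, D.ex, hp]
      · fin_cases s <;> simp [val, hij, ← mul_assoc, D.ex, hp]
  · left; fin_cases t <;> simp [val, ← mul_assoc, D.ey, D.E_a]
  · by_cases hp : p = i
    · right; fin_cases t <;> simp [val, hp, ← mul_assoc, D.ex]
    · left; fin_cases t <;> simp [val, hp, ← mul_assoc, D.ex]
  · left; fin_cases t <;> simp [val, ← mul_assoc, D.E_a, D.E_mul_e0]

lemma x_mul_val_mem (p : Fin 4) (b : D4Index) : D.x p * D.val b ∈ D.comp K (b.deg + 1) := by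
  rcases b with ⟨s, i, j⟩ | ⟨t, j⟩ | ⟨t, i⟩ | t
  · have h : D.x p * D.val (.inl (s, i, j)) = 0 := by
      by_cases hij : i = j <;> fin_cases s <;> simp [val, hij, ← mul_assoc, D.xe, D.xx]
    rw [h]; exact zero_mem _
  · fin_cases t
    · exact D.xy_mem K p j
    · exact D.xay_mem K p _ j
    · exact D.xay_mem K p _ j
    · exact D.xaay_mem K p j
  · have h : D.x p * D.val (.inr (.inr (.inl (t, i)))) = 0 := by
      fin_cases t <;> simp [val, ← mul_assoc, D.xx]
    rw [h]; exact zero_mem _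
  · fin_cases t
    · change D.x p * D.e0 ∈ _
      rw [D.x_mul_e0]; exact D.x_mem K p
    · exact D.xa_mem K p _
    · exact D.xa_mem K p _
    · exact D.xa_mem K p _
    · exact D.xaa_mem K p _ _
    · exact D.xaa_mem K p _ _
    · exact D.xaa_mem K p _ _
    · exact D.xaaa_mem K p

lemma y_mul_val_mem (p : Fin 4) (b : D4Index) : D.y p * D.val b ∈ D.comp K (b.deg + 1) := by
  rcases b with ⟨s, i, j⟩ | ⟨t, j⟩ | ⟨t, i⟩ | t
  · by_cases hp : p = i
    · subst hp
      have hy : ∀ t, D.y p * (D.x p * t) = D.a p * t := fun t => by rw [a, mul_assoc]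
      by_cases hij : p = j
      · subst hij
        fin_cases s
        · simpa [val, D4Index.deg, D.ye] using D.y_mem K p
        · simpa [val, D4Index.deg, hy] using D.aaay_mem K p
      · fin_cases s
        · simpa [val, D4Index.deg, hij, hy] using D.ay_mem K p j
        · simpa [val, D4Index.deg, hij, hy] using D.aay_mem K p (d4Mid p j) j
    · have h : D.y p * D.val (.inl (s, i, j)) = 0 := by
        rcases eq_or_ne i j with rfl | hij
        · fin_cases s <;> simp [val, ← mul_assoc, D.ye, hp, D.yx_ne hp]
        · fin_cases s <;> simp [val, hij, ← mul_assoc, D.yx_ne hp]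
      rw [h]; exact zero_mem _
  · have h : D.y p * D.val (.inr (.inl (t, j))) = 0 := by
      fin_cases t <;> simp [val, ← mul_assoc, D.yy, D.y_a]
    rw [h]; exact zero_mem _
  · by_cases hp : p = i
    · subst hp
      have hy : ∀ t, D.y p * (D.x p * t) = D.a p * t := fun t => by rw [a, mul_assoc]
      fin_cases t
      · exact D.a_mem K p
      · change D.y p * (D.x p * _) ∈ _
        rw [hy]; exact D.aa_mem K _ _
      · change D.y p * (D.x p * _) ∈ _
        rw [hy]; exact D.aa_mem K _ _
      · change D.y p * (D.x p * _) ∈ _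
        rw [hy]; exact D.aaa_mem K _ _ _
    · have h : D.y p * D.val (.inr (.inr (.inl (t, i)))) = 0 := by
        fin_cases t <;> simp [val, ← mul_assoc, D.yx_ne hp]
      rw [h]; exact zero_mem _
  · have h : D.y p * D.val (.inr (.inr (.inr t))) = 0 := by
      fin_cases t <;> simp [val, ← mul_assoc, D.y_mul_e0, D.y_a]
    rw [h]; exact zero_mem _

/-- The element attached to a generator. -/
def gen : GenD4 → A
  | .E i => D.E i
  | .x i => D.x i
  | .y i => D.y i

lemma gen_mul_mem (g : GenD4) {d : ℕ} {t : A} (ht : t ∈ D.comp K d) :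
    D.gen g * t ∈ D.comp K (d + degD4 g) := by
  refine D.mul_mem_of_generators K _ (fun b i j hd => ?_) ht
  have hZ : ∀ s, Commute (D.gen g) (D.Z s) := fun s => by
    cases g
    · exact (D.Z_comm_E s _).symm
    · exact (D.Z_comm_x s _).symm
    · exact (D.Z_comm_y s _).symm
  have hb : D.gen g * D.val b ∈ D.comp K (b.deg + degD4 g) := by
    cases g
    · exact D.E_mul_val_mem K _ b
    · exact D.x_mul_val_mem K _ b
    · exact D.y_mul_val_mem K _ b
  have h : D.gen g * (D.Z 0 ^ i * (D.Z 1 ^ j * D.val b)) =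
      D.Z 0 ^ i * (D.Z 1 ^ j * (D.gen g * D.val b)) := by
    rw [← mul_assoc, ((hZ 0).pow_right i).eq, mul_assoc, ← mul_assoc (D.gen g),
      ((hZ 1).pow_right j).eq, mul_assoc]
  rw [h, show d + degD4 g = b.deg + degD4 g + 4 * j + 4 * i by omega]
  exact D.Z_pow_mul_mem K 0 i (D.Z_pow_mul_mem K 1 j hb)

lemma one_mem_comp : (1 : A) ∈ D.comp K 0 := by
  rw [← sub_add_cancel (1 : A) (∑ i, D.E i)]
  exact add_mem (D.e0_mem K) (sum_mem fun i _ => D.E_mem K i)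

/-- The span of the products of generators of total path length `d`. -/
def wordSpan (d : ℕ) : Submodule K A :=
  Submodule.span K {z | ∃ l : List GenD4, (l.map degD4).sum = d ∧ z = (l.map D.gen).prod}

lemma wordSpan_le_comp (d : ℕ) : D.wordSpan K d ≤ D.comp K d := by
  refine Submodule.span_le.mpr ?_
  rintro z ⟨l, rfl, rfl⟩
  induction l with
  | nil => exact D.one_mem_comp K
  | cons g l ih =>
    rw [List.map_cons, List.map_cons, List.prod_cons, List.sum_cons, add_comm]
    exact D.gen_mul_mem K g ih

lemma one_mem_wordSpan : (1 : A) ∈ D.wordSpan K 0 :=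
  Submodule.subset_span ⟨[], rfl, rfl⟩

lemma gen_mem_wordSpan (g : GenD4) : D.gen g ∈ D.wordSpan K (degD4 g) :=
  Submodule.subset_span ⟨[g], by simp, by simp⟩

lemma mul_mem_wordSpan {d e f : ℕ} {u v : A} (hu : u ∈ D.wordSpan K d) (hv : v ∈ D.wordSpan K e)
    (hf : d + e = f) : u * v ∈ D.wordSpan K f := by
  have h : D.wordSpan K d * D.wordSpan K e ≤ D.wordSpan K (d + e) := by
    rw [wordSpan, wordSpan, Submodule.span_mul_span]
    refine Submodule.span_mono ?_
    rintro _ ⟨_, ⟨l, rfl, rfl⟩, _, ⟨l', rfl, rfl⟩, rfl⟩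
    exact ⟨l ++ l', by simp, by simp⟩
  exact hf ▸ h (Submodule.mul_mem_mul hu hv)

lemma pow_mem_wordSpan {d : ℕ} {u : A} (hu : u ∈ D.wordSpan K d) (n : ℕ) :
    u ^ n ∈ D.wordSpan K (d * n) := by
  induction n with
  | zero => rw [pow_zero, mul_zero]; exact D.one_mem_wordSpan K
  | succ n ih => rw [pow_succ, mul_add_one]; exact D.mul_mem_wordSpan K ih hu rfl

lemma comp_le_wordSpan (d : ℕ) : D.comp K d ≤ D.wordSpan K d := by
  have hE : ∀ i, D.E i ∈ D.wordSpan K 0 := fun i => D.gen_mem_wordSpan K (.E i)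
  have hx : ∀ i, D.x i ∈ D.wordSpan K 1 := fun i => D.gen_mem_wordSpan K (.x i)
  have hy : ∀ i, D.y i ∈ D.wordSpan K 1 := fun i => D.gen_mem_wordSpan K (.y i)
  have ha : ∀ i, D.a i ∈ D.wordSpan K 2 := fun i => D.mul_mem_wordSpan K (hy i) (hx i) rfl
  have haa : ∀ i j, D.a i * D.a j ∈ D.wordSpan K 4 := fun i j =>
    D.mul_mem_wordSpan K (ha i) (ha j) rfl
  have hay : ∀ i j, D.a i * D.y j ∈ D.wordSpan K 3 := fun i j =>
    D.mul_mem_wordSpan K (ha i) (hy j) rfl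
  have haay : ∀ i j l, D.a i * (D.a j * D.y l) ∈ D.wordSpan K 5 := fun i j l =>
    D.mul_mem_wordSpan K (ha i) (hay j l) rfl
  have hxay : ∀ i j l, D.x i * (D.a j * D.y l) ∈ D.wordSpan K 4 := fun i j l =>
    D.mul_mem_wordSpan K (hx i) (hay j l) rfl
  have hZ : ∀ s, D.Z s ∈ D.wordSpan K 4 := fun s =>
    add_mem (add_mem (haa _ _) (haa _ _)) (sum_mem fun i _ => hxay _ _ _)
  have hval : ∀ b, D.val b ∈ D.wordSpan K b.deg := by
    rintro (⟨s, i, j⟩ | ⟨t, j⟩ | ⟨t, i⟩ | t)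
    · by_cases hij : i = j
      · fin_cases s
        · simpa [val, D4Index.deg, hij] using hE j
        · simpa [val, D4Index.deg, hij] using
            D.mul_mem_wordSpan K (hx j) (haay (j + 1) (j + 2) j) rfl
      · fin_cases s
        · simpa [val, D4Index.deg, hij] using D.mul_mem_wordSpan K (hx i) (hy j) rfl
        · simpa [val, D4Index.deg, hij] using hxay i (d4Mid i j) j
    · fin_cases t
      · exact hy j
      · exact hay _ j
      · exact hay _ j
      · exact haay _ _ j
    · fin_cases t
      · exact hx i
      · exact D.mul_mem_wordSpan K (hx i) (ha _) rfl
      · exact D.mul_mem_wordSpan K (hx i) (ha _) rfl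
      · exact D.mul_mem_wordSpan K (hx i) (haa _ _) rfl
    · fin_cases t
      · exact sub_mem (D.one_mem_wordSpan K) (sum_mem fun i _ => hE i)
      · exact ha _
      · exact ha _
      · exact ha _
      · exact haa _ _
      · exact haa _ _
      · exact haa _ _
      · exact D.mul_mem_wordSpan K (ha _) (haa _ _) rfl
  refine Submodule.span_le.mpr ?_
  rintro z ⟨b, i, j, rfl, rfl⟩
  exact D.mul_mem_wordSpan K (D.pow_mem_wordSpan K (hZ 0) i)
    (D.mul_mem_wordSpan K (D.pow_mem_wordSpan K (hZ 1) j) (hval b) rfl) (by ring)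

lemma comp_eq_wordSpan (d : ℕ) : D.comp K d = D.wordSpan K d :=
  le_antisymm (D.comp_le_wordSpan K d) (D.wordSpan_le_comp K d)

end D4System

namespace D4System

variable {A : Type} [Ring A] (D : D4System A)

lemma E_mul_val_mul_E (p q : Fin 4) (s : Fin 2) (i j : Fin 4) :
    D.E p * D.val (.inl (s, i, j)) * D.E q =
      if p = i then if j = q then D.val (.inl (s, i, j)) else 0 else 0 := by
  have h : ∀ t, D.E p * (D.x i * t) = if p = i then D.x i * t else 0 := fun t => by
    rw [← mul_assoc, D.ex, ite_mul, zero_mul]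
    split_ifs with hp
    · rw [hp]
    · rfl
  rcases eq_or_ne i j with rfl | hij
  · fin_cases s
    · by_cases hp : p = i
      · subst hp
        by_cases hq : p = q <;> simp [val, D.ee, hq]
      · simp [val, D.ee, hp]
    · by_cases hq : i = q
      · subst hq
        simp [val, mul_assoc, D.ye, h]
      · simp [val, mul_assoc, hq, D.ye, h]
  · by_cases hq : j = q
    · subst hq
      fin_cases s <;> simp [val, hij, mul_assoc, D.ye, h]
    · fin_cases s <;> simp [val, hij, mul_assoc, hq, D.ye, h]

lemma mul_val_y_mul_E (u : A) (q t j : Fin 4) :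
    u * D.val (.inr (.inl (t, j))) * D.E q =
      if j = q then u * D.val (.inr (.inl (t, j))) else 0 := by
  by_cases hq : j = q <;> fin_cases t <;> simp [val, mul_assoc, D.ye, hq]

lemma E_mul_val_x_mul (u : A) (p t i : Fin 4) :
    D.E p * D.val (.inr (.inr (.inl (t, i)))) * u =
      if p = i then D.val (.inr (.inr (.inl (t, i)))) * u else 0 := by
  by_cases hp : p = i <;> fin_cases t <;> simp [val, ← mul_assoc, D.ex, hp]

lemma E_mul_val_y (p t j : Fin 4) : D.E p * D.val (.inr (.inl (t, j))) = 0 := by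
  fin_cases t <;> simp [val, ← mul_assoc, D.ey, D.E_a]

lemma E_mul_val_center (p : Fin 4) (t : Fin 8) : D.E p * D.val (.inr (.inr (.inr t))) = 0 := by
  fin_cases t <;> simp [val, ← mul_assoc, D.E_a, D.E_mul_e0]

lemma val_x_mul_E (q t i : Fin 4) : D.val (.inr (.inr (.inl (t, i)))) * D.E q = 0 := by
  fin_cases t <;> simp [val, mul_assoc, D.xe, D.a_E]

lemma val_center_mul_E (q : Fin 4) (t : Fin 8) : D.val (.inr (.inr (.inr t))) * D.E q = 0 := by
  fin_cases t <;> simp [val, mul_assoc, D.a_E, D.e0_mul_E]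

lemma x_mul_val_outer (p : Fin 4) (s : Fin 2) (i j : Fin 4) :
    D.x p * D.val (.inl (s, i, j)) = 0 := by
  by_cases hij : i = j <;> fin_cases s <;> simp [val, hij, ← mul_assoc, D.xe, D.xx]

lemma x_mul_val_x (p t i : Fin 4) : D.x p * D.val (.inr (.inr (.inl (t, i)))) = 0 := by
  fin_cases t <;> simp [val, ← mul_assoc, D.xx]

lemma val_outer_mul_y (q : Fin 4) (s : Fin 2) (i j : Fin 4) :
    D.val (.inl (s, i, j)) * D.y q = 0 := by
  by_cases hij : i = j <;> fin_cases s <;> simp [val, hij, mul_assoc, D.ey, D.yy]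

lemma val_y_mul_y (q t j : Fin 4) : D.val (.inr (.inl (t, j))) * D.y q = 0 := by
  fin_cases t <;> simp [val, mul_assoc, D.yy]

variable {R : Type} [CommRing R] [Algebra R A]

/-- A structure recording that all paths between outer vertices are scalar multiples of matrix
units, with nonzero scalars whenever no backtracking at an outer vertex is involved. -/
structure IsGeneric (e : Fin 4 → Fin 4 → A) (c : Fin 4 → Fin 4 → R) : Prop where
  x_mul_y (i j : Fin 4) : D.x i * D.y j = c i j • e i j
  mul_unit (i j l : Fin 4) : e i j * e j l = e i l
  unit_self (i : Fin 4) : e i i = D.E i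
  self_eq_zero (i : Fin 4) : c i i = 0
  ne_zero {i j : Fin 4} : i ≠ j → c i j ≠ 0
  eq_zero_of_smul {r : R} {i j : Fin 4} : r • e i j = 0 → r = 0

variable {D}

namespace IsGeneric

variable {e : Fin 4 → Fin 4 → A} {c : Fin 4 → Fin 4 → R} (hD : D.IsGeneric e c)

include hD

lemma x_a_mul {p i q : Fin 4} {t : A} {r : R} (h : D.x i * t = r • e i q) :
    D.x p * (D.a i * t) = (c p i * r) • e p q := by
  rw [a, mul_assoc, ← mul_assoc, hD.x_mul_y, h, smul_mul_smul_comm, hD.mul_unit]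

lemma x_a_y (p i q : Fin 4) : D.x p * (D.a i * D.y q) = (c p i * c i q) • e p q :=
  hD.x_a_mul (hD.x_mul_y i q)

lemma x_a_a_y (p i j q : Fin 4) :
    D.x p * (D.a i * (D.a j * D.y q)) = (c p i * (c i j * c j q)) • e p q :=
  hD.x_a_mul (hD.x_a_y i j q)

lemma x_a_a_a_y (p i j l q : Fin 4) :
    D.x p * (D.a i * (D.a j * (D.a l * D.y q))) = (c p i * (c i j * (c j l * c l q))) • e p q :=
  hD.x_a_mul (hD.x_a_a_y i j l q)

lemma smul_unit_eq_zero_iff {r : R} {i j : Fin 4} : r • e i j = 0 ↔ r = 0 :=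
  ⟨hD.eq_zero_of_smul, fun h => by rw [h, zero_smul]⟩

variable [IsDomain R]

/-- The basis elements whose degrees agree modulo four are linearly independent. -/
theorem eq_zero_of_sum_smul_val_eq_zero (d : ℕ) (h : D4Index → R)
    (hd : ∀ b, h b ≠ 0 → b.deg % 4 = d % 4) (hs : ∑ b, h b • D.val b = 0) (b : D4Index) :
    h b = 0 := by
  have hsand : ∀ u v, ∑ b, h b • (u * D.val b * v) = 0 := fun u v => by
    have := congrArg (u * · * v) hs
    simp only [Finset.mul_sum, Finset.sum_mul, mul_smul_comm, smul_mul_assoc, mul_zero,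
      zero_mul] at this
    exact this
  have hne : ∀ {n : ℕ} (b : D4Index), b.deg = n → n % 4 ≠ d % 4 → h b = 0 := fun b hb hn => by
    by_contra hb'
    exact hn (hb ▸ hd b hb')
  have c01 := hD.ne_zero (i := 0) (j := 1) (by decide)
  have c10 := hD.ne_zero (i := 1) (j := 0) (by decide)
  have c02 := hD.ne_zero (i := 0) (j := 2) (by decide)
  have c20 := hD.ne_zero (i := 2) (j := 0) (by decide)
  have c12 := hD.ne_zero (i := 1) (j := 2) (by decide)
  have c21 := hD.ne_zero (i := 2) (j := 1) (by decide)
  have d01 := fun i => hD.ne_zero (ne_add_one i)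
  have d10 := fun i => hD.ne_zero (ne_add_one i).symm
  have d02 := fun i => hD.ne_zero (ne_add_two i)
  have d20 := fun i => hD.ne_zero (ne_add_two i).symm
  have d21 := fun i => hD.ne_zero (add_two_ne_add_one i)
  have d12 := fun i => hD.ne_zero (add_two_ne_add_one i).symm
  have hself := hD.self_eq_zero
  rcases b with ⟨s, p, q⟩ | ⟨t, q⟩ | ⟨t, p⟩ | t
  · have h1 : ∑ s, h (.inl (s, p, q)) • D.val (.inl (s, p, q)) = 0 := by
      have h1 := hsand (D.E p) (D.E q)
      simpa [Fintype.sum_sum_type, Fintype.sum_prod_type, D.E_mul_val_mul_E, D.E_mul_val_y,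
        mul_assoc (D.E p) (D.val (.inr (.inr _))), D.val_x_mul_E, D.val_center_mul_E] using h1
    rcases eq_or_ne p q with rfl | hpq
    · have ha := hne (n := 0) (.inl (0, p, p)) (by simp [D4Index.deg])
      have hb := hne (n := 6) (.inl (1, p, p)) (by simp [D4Index.deg])
      have hpp := hD.unit_self p
      by_cases hd0 : d % 4 = 0
      · have hb := hb (by omega)
        rw [Fin.sum_univ_two, hb, zero_smul, add_zero] at h1
        simp only [val, if_true, Matrix.cons_val_zero, ← hpp, hD.smul_unit_eq_zero_iff] at h1
        fin_cases s
        exacts [h1, hb]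
      · have ha := ha (by omega)
        rw [Fin.sum_univ_two, ha, zero_smul, zero_add] at h1
        simp [val, hD.x_a_a_y, smul_smul, hD.smul_unit_eq_zero_iff, d01 p, d20 p, d12 p] at h1
        fin_cases s
        exacts [ha, h1]
    · have ha := hne (n := 2) (.inl (0, p, q)) (by simp [D4Index.deg, hpq])
      have hb := hne (n := 4) (.inl (1, p, q)) (by simp [D4Index.deg, hpq])
      by_cases hd0 : d % 4 = 0
      · have ha := ha (by omega)
        have hm : p ≠ d4Mid p q ∧ d4Mid p q ≠ q := by
          clear * - hpq
          revert p q
          decide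
        rw [Fin.sum_univ_two, ha, zero_smul, zero_add] at h1
        simp [val, hpq, hD.x_a_y, smul_smul, hD.smul_unit_eq_zero_iff, hD.ne_zero hm.1,
          hD.ne_zero hm.2] at h1
        fin_cases s
        exacts [ha, h1]
      · have hb := hb (by omega)
        rw [Fin.sum_univ_two, hb, zero_smul, add_zero] at h1
        simp [val, hpq, hD.x_mul_y, smul_smul, hD.smul_unit_eq_zero_iff, hD.ne_zero hpq] at h1
        fin_cases s
        exacts [h1, hb]
  · have h1 : ∀ p, ∑ t, h (.inr (.inl (t, q))) • (D.x p * D.val (.inr (.inl (t, q)))) = 0 :=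
      fun p => by
        have h1 := hsand (D.x p) (D.E q)
        simpa [Fintype.sum_sum_type, Fintype.sum_prod_type, D.mul_val_y_mul_E, D.x_mul_val_outer,
          D.x_mul_val_x, mul_assoc (D.x p) (D.val (.inr (.inr (.inr _)))), D.val_center_mul_E]
          using h1
    have ha := hne (n := 1) (.inr (.inl (0, q))) rfl
    have hb := hne (n := 3) (.inr (.inl (1, q))) rfl
    have hc := hne (n := 3) (.inr (.inl (2, q))) rfl
    have he := hne (n := 5) (.inr (.inl (3, q))) rfl
    simp only [Fin.sum_univ_four] at h1
    by_cases hd1 : d % 4 = 1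
    · have hb := hb (by omega)
      have hc := hc (by omega)
      simp only [hb, hc, zero_smul, add_zero] at h1
      have h3 := h1 q
      simp [val, hD.x_mul_y, hD.x_a_a_y, hself, smul_smul, hD.smul_unit_eq_zero_iff, d01, d12,
        d20] at h3
      have h0 := h1 (q + 1)
      simp [h3, val, hD.x_mul_y, smul_smul, hD.smul_unit_eq_zero_iff, d10] at h0
      fin_cases t
      exacts [h0, hb, hc, h3]
    · have ha := ha (by omega)
      have he := he (by omega)
      simp only [ha, he, zero_smul, add_zero, zero_add] at h1
      have h2 := h1 (q + 1)
      simp [val, hD.x_a_y, hself, smul_smul, hD.smul_unit_eq_zero_iff, d12, d20] at h2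
      have h3 := h1 (q + 2)
      simp [val, hD.x_a_y, hself, smul_smul, hD.smul_unit_eq_zero_iff, d21, d10] at h3
      fin_cases t
      exacts [ha, h3, h2, he]
  · have h1 : ∀ q, ∑ t, h (.inr (.inr (.inl (t, p)))) •
        (D.val (.inr (.inr (.inl (t, p)))) * D.y q) = 0 :=
      fun q => by
        have h1 := hsand (D.E p) (D.y q)
        simpa [Fintype.sum_sum_type, Fintype.sum_prod_type, D.E_mul_val_x_mul, D.E_mul_val_y,
          D.E_mul_val_center, mul_assoc (D.E p) (D.val (.inl _)), D.val_outer_mul_y] using h1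
    have ha := hne (n := 1) (.inr (.inr (.inl (0, p)))) rfl
    have hb := hne (n := 3) (.inr (.inr (.inl (1, p)))) rfl
    have hc := hne (n := 3) (.inr (.inr (.inl (2, p)))) rfl
    have he := hne (n := 5) (.inr (.inr (.inl (3, p)))) rfl
    simp only [Fin.sum_univ_four] at h1
    by_cases hd1 : d % 4 = 1
    · have hb := hb (by omega)
      have hc := hc (by omega)
      simp only [hb, hc, zero_smul, add_zero] at h1
      have h3 := h1 p
      simp [val, mul_assoc, hD.x_mul_y, hD.x_a_a_y, hself, smul_smul, hD.smul_unit_eq_zero_iff,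
        d01, d12, d20] at h3
      have h0 := h1 (p + 1)
      simp [h3, val, mul_assoc, hD.x_mul_y, smul_smul,
        hD.smul_unit_eq_zero_iff, d01] at h0
      fin_cases t
      exacts [h0, hb, hc, h3]
    · have ha := ha (by omega)
      have he := he (by omega)
      simp only [ha, he, zero_smul, add_zero, zero_add] at h1
      have h2 := h1 (p + 1)
      simp [val, mul_assoc, hD.x_a_y, hself, smul_smul,
        hD.smul_unit_eq_zero_iff, d21, d02] at h2
      have h3 := h1 (p + 2)
      simp [val, mul_assoc, hD.x_a_y, hself, smul_smul,
        hD.smul_unit_eq_zero_iff, d12, d01] at h3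
      fin_cases t
      exacts [ha, h3, h2, he]
  · have h1 : ∀ p q, ∑ t, h (.inr (.inr (.inr t))) •
        (D.x p * D.val (.inr (.inr (.inr t))) * D.y q) = 0 :=
      fun p q => by
        have h1 := hsand (D.x p) (D.y q)
        simpa [Fintype.sum_sum_type, Fintype.sum_prod_type, D.x_mul_val_outer, D.x_mul_val_x,
          mul_assoc (D.x p) (D.val (.inr (.inl _))), D.val_y_mul_y] using h1
    have hz := fun (t : Fin 8) => hne (.inr (.inr (.inr t))) rfl
    simp only [Fin.sum_univ_eight] at h1
    by_cases hd0 : d % 4 = 0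
    · have hz1 := hz 1 (by simp [D4Index.deg, hd0])
      have hz2 := hz 2 (by simp [D4Index.deg, hd0])
      have hz3 := hz 3 (by simp [D4Index.deg, hd0])
      have hz7 := hz 7 (by simp [D4Index.deg, hd0])
      simp only [hz1, hz2, hz3, hz7, val, Matrix.cons_val, mul_assoc, D.e0_mul_y, hD.x_mul_y,
        hD.x_a_a_y, zero_smul, add_zero] at h1
      have h6 := h1 0 0
      simp [hself, smul_smul, hD.smul_unit_eq_zero_iff, c01, c12, c20] at h6
      have h0 := h1 0 1
      simp [h6, hself, smul_smul, hD.smul_unit_eq_zero_iff, c01] at h0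
      have h5 := h1 1 1
      simp [h6, h0, hself, smul_smul, hD.smul_unit_eq_zero_iff, c10, c02, c21] at h5
      have h4 := h1 2 2
      simp [h6, h0, h5, hself, smul_smul, hD.smul_unit_eq_zero_iff, c20, c01, c12] at h4
      fin_cases t
      exacts [h0, hz1, hz2, hz3, h4, h5, h6, hz7]
    · have hz0 := hz 0 (by simp [D4Index.deg, Ne.symm hd0])
      have hz4 := hz 4 (by simp [D4Index.deg, Ne.symm hd0])
      have hz5 := hz 5 (by simp [D4Index.deg, Ne.symm hd0])
      have hz6 := hz 6 (by simp [D4Index.deg, Ne.symm hd0])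
      simp only [hz0, hz4, hz5, hz6, val, Matrix.cons_val, mul_assoc, hD.x_a_y,
        hD.x_a_a_a_y, zero_smul, add_zero, zero_add] at h1
      have h3 := h1 0 1
      simp [hself, smul_smul, hD.smul_unit_eq_zero_iff, c02, c21] at h3
      have h2 := h1 0 0
      simp [h3, hself, smul_smul, hD.smul_unit_eq_zero_iff, c01, c10] at h2
      have h4 := h1 1 2
      simp [h3, h2, hself, smul_smul, hD.smul_unit_eq_zero_iff, c10, c02] at h4
      have h7 := h1 1 1
      simp [h3, h2, h4, smul_smul, hD.smul_unit_eq_zero_iff, c10, c01, c12, c21] at h7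
      fin_cases t
      exacts [hz0, h4, h2, h3, hz4, hz5, hz6, h7]

end IsGeneric

end D4System

section MatrixModel

open Polynomial Matrix

/-- Row vectors of the inward arrows in the generic matrix model. -/
def d4Row : Fin 4 → Fin 2 → k[X] := ![![1, 0], ![0, 1], ![1, 1], ![1, 1 + X]]

/-- Scalars making the squares of the linear forms `d4Row` linearly dependent. -/
def d4Weight : Fin 4 → k[X] := ![X, -(X * (X + 1)), -(X + 1), 1]

/-- Column vectors of the outward arrows in the generic matrix model. -/
def d4Col (i : Fin 4) : Fin 2 → k[X] :=
  ![-(d4Weight k i * d4Row k i 1), d4Weight k i * d4Row k i 0]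

/-- The algebra of the generic matrix model. -/
abbrev D4Matrix := Matrix (Fin 4 ⊕ Fin 2) (Fin 4 ⊕ Fin 2) k[X]

/-- Matrix units of the outer block. -/
def d4Unit (i j : Fin 4) : D4Matrix k :=
  fromBlocks (vecMulVec (Pi.single i 1) (Pi.single j 1)) 0 0 0

lemma d4Row_dotProduct_d4Col_self (i : Fin 4) : d4Row k i ⬝ᵥ d4Col k i = 0 := by
  simp only [d4Col, dotProduct, Fin.sum_univ_two, cons_val_zero, cons_val_one]
  ring

lemma sum_vecMulVec_d4Col_d4Row : ∑ i, vecMulVec (d4Col k i) (d4Row k i) = 0 := by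
  ext i j : 1
  simp only [Matrix.sum_apply, vecMulVec_apply, Fin.sum_univ_four, Matrix.zero_apply]
  fin_cases i <;> fin_cases j <;> simp [d4Col, d4Row, d4Weight] <;> ring

lemma vecMulVec_mul_of_dotProduct_eq_zero {l m n R : Type*} [Fintype m] [CommRing R] {u : l → R}
    {v w : m → R} {t : n → R} (h : v ⬝ᵥ w = 0) : vecMulVec u v * vecMulVec w t = 0 := by
  rw [vecMulVec_mul_vecMulVec, h, zero_smul]
  ext i j
  simp [vecMulVec_apply]

/-- A representation of the preprojective algebra of `D̃₄` by polynomial matrices. -/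
def d4MatrixSystem : D4System (D4Matrix k) where
  E i := d4Unit k i i
  x i := fromBlocks 0 (vecMulVec (Pi.single i 1) (d4Row k i)) 0 0
  y i := fromBlocks 0 0 (vecMulVec (d4Col k i) (Pi.single i 1)) 0
  ee i j := by
    rcases eq_or_ne i j with rfl | h <;>
      simp [d4Unit, fromBlocks_multiply, vecMulVec_mul_vecMulVec, *]
  ex i j := by
    rcases eq_or_ne i j with rfl | h
    · simp [d4Unit, fromBlocks_multiply, vecMulVec_mul_vecMulVec]
    · simp [d4Unit, fromBlocks_multiply, vecMulVec_mul_of_dotProduct_eq_zero, h]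
  ye i j := by
    rcases eq_or_ne i j with rfl | h
    · simp [d4Unit, fromBlocks_multiply, vecMulVec_mul_vecMulVec]
    · simp [d4Unit, fromBlocks_multiply, vecMulVec_mul_of_dotProduct_eq_zero, h]
  xe i j := by simp [d4Unit, fromBlocks_multiply]
  ey i j := by simp [d4Unit, fromBlocks_multiply]
  xx i j := by simp [fromBlocks_multiply]
  yy i j := by simp [fromBlocks_multiply]
  yx := by
    have h := sum_vecMulVec_d4Col_d4Row k
    rw [Fin.sum_univ_four] at h
    simp [Fin.sum_univ_four, fromBlocks_multiply, vecMulVec_mul_vecMulVec, fromBlocks_add, h]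
  xy := by
    simp only [fromBlocks_multiply, vecMulVec_mul_vecMulVec, d4Row_dotProduct_d4Col_self]
    simp

lemma d4MatrixSystem_isGeneric :
    (d4MatrixSystem k).IsGeneric (d4Unit k) (fun i j => d4Row k i ⬝ᵥ d4Col k j) where
  x_mul_y i j := by
    simp [d4MatrixSystem, d4Unit, fromBlocks_multiply, vecMulVec_mul_vecMulVec, fromBlocks_smul]
  mul_unit i j l := by simp [d4Unit, fromBlocks_multiply, vecMulVec_mul_vecMulVec]
  unit_self i := rfl
  self_eq_zero := d4Row_dotProduct_d4Col_self k
  ne_zero {i j} h := by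
    have hX : (X : k[X]) + 1 ≠ 0 := (monic_X_add_C (1 : k)).ne_zero
    fin_cases i <;> fin_cases j <;>
      simp [dotProduct, d4Col, d4Row, d4Weight, hX] at h ⊢
    · exact fun h => hX (by linear_combination -h)
    · exact fun h => hX (by linear_combination -h)
    · exact fun h => hX (by linear_combination h)
    · exact fun h => mul_ne_zero X_ne_zero hX (by linear_combination -h)
  eq_zero_of_smul {r i j} h := by
    have := congrFun (congrFun h (.inl i)) (.inl j)
    simpa [d4Unit, vecMulVec_apply] using this

lemma sum_d4Unit : ∑ i, d4Unit k i i = fromBlocks 1 0 0 0 := by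
  ext i j : 1
  rcases i with i | i <;> rcases j with j | j <;>
    simp [Matrix.sum_apply, d4Unit, vecMulVec_apply, one_apply, Pi.single_apply]

lemma d4MatrixSystem_Z_eq_smul (s : Fin 3) (z : k[X])
    (h : ∀ i, (d4Row k i ⬝ᵥ d4Col k (d4Pair s i)) * (d4Row k (d4Pair s i) ⬝ᵥ d4Col k i) = z)
    (h' : ∀ i j, (d4Row k 0 ⬝ᵥ d4Col k (d4Pair s 0)) * (d4Col k 0 i * d4Row k (d4Pair s 0) j) +
      (d4Row k (d4Pair s 0) ⬝ᵥ d4Col k 0) * (d4Col k (d4Pair s 0) i * d4Row k 0 j) =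
        if i = j then z else 0) :
    (d4MatrixSystem k).Z s = z • 1 := by
  have ha : ∀ i, (d4MatrixSystem k).a i =
      fromBlocks 0 0 0 (vecMulVec (d4Col k i) (d4Row k i)) := fun i => by
    simp [D4System.a, d4MatrixSystem, fromBlocks_multiply, vecMulVec_mul_vecMulVec]
  have houter : ∑ i, (d4MatrixSystem k).x i *
      ((d4MatrixSystem k).a (d4Pair s i) * (d4MatrixSystem k).y i) = fromBlocks (z • 1) 0 0 0 := by
    simp only [(d4MatrixSystem_isGeneric k).x_a_y, h, ← Finset.smul_sum, sum_d4Unit,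
      fromBlocks_smul, smul_zero]
  have hcentre : (d4MatrixSystem k).a 0 * (d4MatrixSystem k).a (d4Pair s 0) +
      (d4MatrixSystem k).a (d4Pair s 0) * (d4MatrixSystem k).a 0 = fromBlocks 0 0 0 (z • 1) := by
    simp only [ha, fromBlocks_multiply, vecMulVec_mul_vecMulVec, fromBlocks_add,
      Matrix.mul_zero, Matrix.zero_mul, add_zero, zero_add]
    refine congrArg (fromBlocks (0 : Matrix (Fin 4) (Fin 4) k[X]) 0 0) ?_
    ext i j : 1
    simp only [Matrix.add_apply, Matrix.smul_apply, vecMulVec_apply, Pi.smul_apply, smul_eq_mul,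
      one_apply, mul_ite, mul_one, mul_zero, ← h' i j]
    ring
  rw [D4System.Z, hcentre, houter, ← fromBlocks_one, fromBlocks_smul, fromBlocks_add]
  simp

lemma d4MatrixSystem_Z_zero : (d4MatrixSystem k).Z 0 = (X * (X * (X + 1)) : k[X]) • 1 := by
  apply d4MatrixSystem_Z_eq_smul
  · intro i
    fin_cases i <;> simp [dotProduct, d4Col, d4Row, d4Weight, d4Pair] <;> ring
  · intro i j
    fin_cases i <;> fin_cases j <;> simp [dotProduct, d4Col, d4Row, d4Weight, d4Pair]
    ring

lemma d4MatrixSystem_Z_one : (d4MatrixSystem k).Z 1 = (X * (X + 1) : k[X]) • 1 := by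
  apply d4MatrixSystem_Z_eq_smul
  · intro i
    fin_cases i <;> simp [dotProduct, d4Col, d4Row, d4Weight, d4Pair]
    ring
  · intro i j
    fin_cases i <;> fin_cases j <;> simp [dotProduct, d4Col, d4Row, d4Weight, d4Pair] <;> ring

end MatrixModel

namespace D4System

variable {A B : Type} [Ring A] [Ring B]

lemma map_val {D : D4System A} {D' : D4System B} (φ : A →+* B) (hE : ∀ i, φ (D.E i) = D'.E i)
    (hx : ∀ i, φ (D.x i) = D'.x i) (hy : ∀ i, φ (D.y i) = D'.y i) (b : D4Index) :
    φ (D.val b) = D'.val b := by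
  have ha : ∀ i, φ (D.a i) = D'.a i := fun i => by simp [a, hx, hy]
  have he0 : φ D.e0 = D'.e0 := by simp [e0, hE]
  rcases b with ⟨s, i, j⟩ | ⟨t, j⟩ | ⟨t, i⟩ | t
  · by_cases hij : i = j <;> fin_cases s <;> simp [val, hij, hE, hx, hy, ha]
  · fin_cases t <;> simp [val, hy, ha]
  · fin_cases t <;> simp [val, hx, ha]
  · fin_cases t <;> simp [val, ha, he0]

lemma map_Z {D : D4System A} {D' : D4System B} (φ : A →+* B)
    (hx : ∀ i, φ (D.x i) = D'.x i) (hy : ∀ i, φ (D.y i) = D'.y i) (s : Fin 3) :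
    φ (D.Z s) = D'.Z s := by
  simp [Z, a, hx, hy]

end D4System

/-- The quotient map onto the preprojective algebra of `D̃₄`. -/
def preprojD4Mk : FreeAlgebra k GenD4 →ₐ[k] PreprojD4 k := RingQuot.mkAlgHom k (RelD4 k)

lemma preprojD4Mk_rel {u v : FreeAlgebra k GenD4} (h : RelD4 k u v) :
    preprojD4Mk k u = preprojD4Mk k v :=
  RingQuot.mkAlgHom_rel k h

/-- The tautological system in the preprojective algebra of `D̃₄`. -/
def preprojD4System : D4System (PreprojD4 k) where
  E i := preprojD4Mk k (gd4 k (.E i))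
  x i := preprojD4Mk k (gd4 k (.x i))
  y i := preprojD4Mk k (gd4 k (.y i))
  ee i j := by
    rw [← map_mul, preprojD4Mk_rel k (.ee i j), apply_ite (preprojD4Mk k), map_zero]
  ex i j := by
    rw [← map_mul, preprojD4Mk_rel k (.ex i j), apply_ite (preprojD4Mk k), map_zero]
  ye i j := by
    rw [← map_mul, preprojD4Mk_rel k (.ye i j), apply_ite (preprojD4Mk k), map_zero]
  xe i j := by rw [← map_mul, preprojD4Mk_rel k (.xe i j), map_zero]
  ey i j := by rw [← map_mul, preprojD4Mk_rel k (.ey i j), map_zero]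
  xx i j := by rw [← map_mul, preprojD4Mk_rel k (.xx i j), map_zero]
  yy i j := by rw [← map_mul, preprojD4Mk_rel k (.yy i j), map_zero]
  yx := by simpa using preprojD4Mk_rel k .yx
  xy := by simpa using preprojD4Mk_rel k .xy

lemma preprojD4System_gen (g : GenD4) : (preprojD4System k).gen g = preprojD4Mk k (gd4 k g) := by
  cases g <;> rfl

lemma preprojD4Comp_eq_comp (d : ℕ) :
    PreprojD4Comp k d = (preprojD4System k).comp k d := by
  rw [D4System.comp_eq_wordSpan, D4System.wordSpan, funext (preprojD4System_gen k)]
  rfl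

section Lift

variable {B : Type} [Ring B] [Algebra k B] (D : D4System B)

lemma lift_gen_gd4 (g : GenD4) : FreeAlgebra.lift k D.gen (gd4 k g) = D.gen g := by
  simp [gd4]

/-- The homomorphism from the preprojective algebra of `D̃₄` given by a system. -/
def preprojD4Lift : PreprojD4 k →ₐ[k] B :=
  RingQuot.liftAlgHom k ⟨FreeAlgebra.lift k D.gen, fun u v h => by
    cases h <;> simp only [map_mul, map_sum, map_zero, lift_gen_gd4,
      apply_ite (FreeAlgebra.lift k D.gen), D4System.gen, D.ee, D.ex, D.ye, D.xe, D.ey, D.xx,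
      D.yy, D.yx, D.xy]⟩

lemma preprojD4Lift_gen (g : GenD4) :
    preprojD4Lift k D ((preprojD4System k).gen g) = D.gen g := by
  rw [preprojD4System_gen]
  exact (RingQuot.liftAlgHom_mkAlgHom_apply k _ _ _).trans (lift_gen_gd4 k D g)

lemma preprojD4Lift_val (b : D4Index) :
    preprojD4Lift k D ((preprojD4System k).val b) = D.val b :=
  D4System.map_val (preprojD4Lift k D : PreprojD4 k →+* B) (fun i => preprojD4Lift_gen k D (.E i))
    (fun i => preprojD4Lift_gen k D (.x i)) (fun i => preprojD4Lift_gen k D (.y i)) b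

lemma preprojD4Lift_Z (s : Fin 3) :
    preprojD4Lift k D ((preprojD4System k).Z s) = D.Z s :=
  D4System.map_Z (preprojD4Lift k D : PreprojD4 k →+* B)
    (fun i => preprojD4Lift_gen k D (.x i)) (fun i => preprojD4Lift_gen k D (.y i)) s

end Lift

/-- The number of pairs `(i, j)` for which `Z 0 ^ i * Z 1 ^ j * val b` has degree `d`. -/
def d4Count (d : ℕ) (b : D4Index) : ℕ :=
  if b.deg ≤ d ∧ (d - b.deg) % 4 = 0 then (d - b.deg) / 4 + 1 else 0

/-- The monomial basis of the degree-`d` component of the preprojective algebra of `D̃₄`. -/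
def preprojD4Family (d : ℕ) (p : Σ b : D4Index, Fin (d4Count d b)) : PreprojD4 k :=
  (preprojD4System k).Z 0 ^ (p.2 : ℕ) *
    ((preprojD4System k).Z 1 ^ (d4Count d p.1 - 1 - p.2) * (preprojD4System k).val p.1)

lemma deg_add_of_lt_d4Count {d : ℕ} {b : D4Index} {n : ℕ} (h : n < d4Count d b) :
    b.deg + 4 * (d4Count d b - 1) = d := by
  unfold d4Count at *
  split_ifs at * <;> omega

lemma span_range_preprojD4Family (d : ℕ) :
    Submodule.span k (Set.range (preprojD4Family k d)) = PreprojD4Comp k d := by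
  rw [preprojD4Comp_eq_comp, D4System.comp]
  congr 1
  ext z
  constructor
  · rintro ⟨⟨b, i, hi⟩, rfl⟩
    refine ⟨b, i, d4Count d b - 1 - i, ?_, rfl⟩
    have := deg_add_of_lt_d4Count hi
    omega
  · rintro ⟨b, i, j, hd, rfl⟩
    have hc : d4Count d b = i + j + 1 := by
      rw [d4Count, if_pos (by omega)]
      omega
    refine ⟨⟨b, i, by omega⟩, ?_⟩
    simp only [preprojD4Family, hc]
    congr 3
    omega

open Polynomial in
lemma linearIndependent_preprojD4Family (d : ℕ) : LinearIndependent k (preprojD4Family k d) := by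
  refine LinearIndependent.of_comp (preprojD4Lift k (d4MatrixSystem k)).toLinearMap ?_
  have hF : ∀ p : Σ b : D4Index, Fin (d4Count d b),
      preprojD4Lift k (d4MatrixSystem k) (preprojD4Family k d p) =
        (X ^ (p.2 : ℕ) * (X * (X + 1)) ^ (d4Count d p.1 - 1) : k[X]) •
          (d4MatrixSystem k).val p.1 := fun ⟨b, i, hi⟩ => by
    have h : d4Count d b - 1 = i + (d4Count d b - 1 - i) := by omega
    simp only [preprojD4Family, map_mul, map_pow, preprojD4Lift_val, preprojD4Lift_Z,
      d4MatrixSystem_Z_zero, d4MatrixSystem_Z_one, _root_.smul_pow, one_pow, smul_mul_assoc,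
      one_mul, smul_smul]
    congr 1
    rw [mul_pow X (X * (X + 1)) i]
    nth_rw 2 [h]
    ring
  rw [Fintype.linearIndependent_iff]
  intro g hg ⟨b, i⟩
  set G : D4Index → k[X] := fun b =>
    (∑ i : Fin (d4Count d b), C (g ⟨b, i⟩) * X ^ (i : ℕ)) * (X * (X + 1)) ^ (d4Count d b - 1)
  have hG : G b = 0 := by
    refine (d4MatrixSystem_isGeneric k).eq_zero_of_sum_smul_val_eq_zero d G (fun b hb => ?_) ?_ b
    · rcases Nat.eq_zero_or_pos (d4Count d b) with h | h
      · have : IsEmpty (Fin (d4Count d b)) := by rw [h]; infer_instance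
        simp [G] at hb
      · have := deg_add_of_lt_d4Count h
        omega
    · rw [← hg, Fintype.sum_sigma]
      refine Finset.sum_congr rfl fun b _ => ?_
      simp only [G, Finset.sum_mul, Finset.sum_smul]
      refine Finset.sum_congr rfl fun i _ => ?_
      simp only [Function.comp_apply, AlgHom.toLinearMap_apply, hF]
      rw [mul_assoc, C_mul', smul_assoc]
  have hX : (X * (X + 1) : k[X]) ≠ 0 := mul_ne_zero X_ne_zero (monic_X_add_C (1 : k)).ne_zero
  have h := (mul_eq_zero.mp hG).resolve_right (pow_ne_zero _ hX)
  have hi := congrArg (coeff · i) h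
  simpa [finsetSum_coeff, coeff_X_pow, Fin.val_inj, eq_comm] using hi

lemma sum_d4Count (d : ℕ) :
    ∑ b, d4Count d b = if Even d then 5 * (d + 1) else 4 * (d + 1) := by
  have hs : ∀ c : ℕ → ℕ, ∑ b : D4Index, c b.deg =
      5 * c 0 + 8 * c 1 + 15 * c 2 + 16 * c 3 + 15 * c 4 + 8 * c 5 + 5 * c 6 := fun c => by
    simp [Fintype.sum_sum_type, Fintype.sum_prod_type, D4Index.deg, Fin.sum_univ_four,
      Fin.sum_univ_two, Fin.sum_univ_eight]
    ring
  have hc : ∀ b, d4Count d b = if b.deg % 4 = d % 4 then (d + 4 - b.deg) / 4 else 0 := fun b => by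
    have hb : b.deg ≤ 6 := by revert b; decide
    unfold d4Count
    split_ifs <;> omega
  rw [Finset.sum_congr rfl fun b _ => hc b]
  refine (hs fun n => if n % 4 = d % 4 then (d + 4 - n) / 4 else 0).trans ?_
  have hd : d % 4 = 0 ∨ d % 4 = 1 ∨ d % 4 = 2 ∨ d % 4 = 3 := by omega
  rcases hd with hd | hd | hd | hd <;> simp [hd, Nat.even_iff] <;> split_ifs <;> omega
/-- The Hilbert series of the preprojective algebra of the extended Dynkin quiver `D̃₄`:
the degree-`d` component has dimension `5(d+1)` for `d` even and `4(d+1)` for `d` odd;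
equivalently the Hilbert series is `(5 + 8t + 5t²)/(1−t²)²`. -/
theorem preprojD4_hilbert (d : ℕ) :
    Module.rank k (PreprojD4Comp k d) =
      ((if Even d then 5 * (d + 1) else 4 * (d + 1) : ℕ) : Cardinal) := by
  have hli := linearIndependent_preprojD4Family k d
  rw [← span_range_preprojD4Family, rank_span hli, Cardinal.mk_range_eq _ hli.injective,
    Cardinal.mk_fintype, Fintype.card_sigma]
  simp only [Fintype.card_fin, sum_d4Count]

end
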